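/- arXiv:2601.20111 — 2 statements merged into one kernel-verified Lean document; each statement's English description precedes it below -/
import Mathlib

section
/- Let 𝐬 = ([i_1,j_1],…,[i_r,j_r]) ∈ 𝐒ˢ be prime with signs ε_1,…,ε_r and let 0 ≤ p+1 < ℓ ≤ r. Then: (1) if 1 ≤ p ≤ r−3, i_p ≠ i_{p+3} and j_p ≠ j_{p+3}, then 𝐬_{1,0}(p,ℓ+1) (with the induced signs) is a prime element of 𝐒ˢ; (2) if 2 ≤ ℓ ≤ r−2, i_{ℓ−1} ≠ i_{ℓ+2} and j_{ℓ−1} ≠ j_{ℓ+2}, then 𝐬_{0,1}(p,ℓ+1) is a prime element of 𝐒ˢ; (3) if both hypotheses of (1) and (2) hold, then 𝐬_{1,1}(p,ℓ+1) is a prime element of 𝐒ˢ. -/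
/-- The interval `[a,b]` belongs to `𝕀ₙ` (integer intervals with `0 ≤ b - a ≤ n+1`). -/
def InIntv (n : ℕ) (a b : ℤ) : Prop := 0 ≤ b - a ∧ b - a ≤ (n : ℤ) + 1

/-- `([i 1, j 1], …, [i r, j r])` together with signs `ε 1, …, ε r ∈ {0,1}` is a
stable alternating snake of sink–source type (`𝐬 ∈ 𝐒ˢ`). -/
def IsSnake (n r : ℕ) (i j : ℕ → ℤ) (ε : ℕ → ℕ) : Prop :=
  (∀ s, 1 ≤ s → s ≤ r → InIntv n (i s) (j s)) ∧
  (∀ s, 1 ≤ s → s ≤ r → ε s ≤ 1) ∧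
  (∀ s p, 1 ≤ s → s < p → p ≤ r → ¬(i s = i p ∧ j s = j p)) ∧
  (∀ p, 1 ≤ p → p + 1 ≤ r →
    ε p + ε (p + 1) = 1 ∧ i (p + 1 - ε p) < i (p + ε p) ∧ j (p + 1 - ε p) < j (p + ε p)) ∧
  (∀ p s, 1 ≤ p → p + 2 ≤ s → s ≤ r → i p ≤ i s ∧ i s < j s ∧ j s ≤ j p)

/-- The snake `𝐬` is connected. -/
def IsConnectedSnake (n r : ℕ) (i j : ℕ → ℤ) (ε : ℕ → ℕ) : Prop :=
  IsSnake n r i j ε ∧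
  ∀ p, 1 ≤ p → p + 1 ≤ r →
    i (p + 1 - ε p) < i (p + ε p) ∧ i (p + ε p) ≤ j (p + 1 - ε p) ∧
      j (p + 1 - ε p) < j (p + ε p) ∧ j (p + ε p) - i (p + 1 - ε p) ≤ (n : ℤ) + 1

/-- The snake `𝐬` is prime. -/
def IsPrimeSnake (n r : ℕ) (i j : ℕ → ℤ) (ε : ℕ → ℕ) : Prop :=
  IsConnectedSnake n r i j ε ∧
  ∀ s, 1 ≤ s → s + 2 ≤ r → i s ≠ i (s + 2) ∧ j s ≠ j (s + 2)

/-- Consecutive intervals `[a,b]`, `[c,d]` with signs `e`, `e'` satisfy the alternation and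
connectedness conditions. -/
def Linked (n : ℕ) (a b : ℤ) (e : ℕ) (c d : ℤ) (e' : ℕ) : Prop :=
  (e = 0 ∧ e' = 1 ∧ c < a ∧ a ≤ d ∧ d < b ∧ b - c ≤ (n : ℤ) + 1) ∨
  (e = 1 ∧ e' = 0 ∧ a < c ∧ c ≤ b ∧ b < d ∧ d - a ≤ (n : ℤ) + 1)

theorem IsPrimeSnake.linked {n r : ℕ} {i j : ℕ → ℤ} {ε : ℕ → ℕ} (h : IsPrimeSnake n r i j ε)
    {p : ℕ} (hp : 1 ≤ p) (hpr : p + 1 ≤ r) :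
    Linked n (i p) (j p) (ε p) (i (p + 1)) (j (p + 1)) (ε (p + 1)) := by
  obtain ⟨⟨⟨-, -, -, hb, -⟩, hc⟩, -⟩ := h
  have hsum := (hb p hp hpr).1
  have hconn := hc p hp hpr
  rcases (by omega : ε p = 0 ∨ ε p = 1) with h0 | h0 <;> rw [h0] at hconn hsum <;>
    simp only [Nat.sub_zero, Nat.add_zero, Nat.add_sub_cancel] at hconn <;>
    unfold Linked <;> omega

theorem IsPrimeSnake.nested {n r : ℕ} {i j : ℕ → ℤ} {ε : ℕ → ℕ} (h : IsPrimeSnake n r i j ε)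
    {p s : ℕ} (hp : 1 ≤ p) (hps : p + 2 ≤ s) (hs : s ≤ r) : i p ≤ i s ∧ i s < j s ∧ j s ≤ j p :=
  h.1.1.2.2.2.2 p s hp hps hs

theorem IsPrimeSnake.nested_two {n r : ℕ} {i j : ℕ → ℤ} {ε : ℕ → ℕ} (h : IsPrimeSnake n r i j ε)
    {p : ℕ} (hp : 1 ≤ p) (hpr : p + 2 ≤ r) : i p < i (p + 2) ∧ j (p + 2) < j p := by
  have h1 := h.nested hp le_rfl hpr
  have h2 := h.2 p hp hpr
  omega

/-- The distinctness condition of a snake follows from the other conditions of primeness. -/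
theorem IsPrimeSnake.of_linked {n r : ℕ} {i j : ℕ → ℤ} {ε : ℕ → ℕ}
    (hI : ∀ s, 1 ≤ s → s ≤ r → InIntv n (i s) (j s))
    (hε : ∀ s, 1 ≤ s → s ≤ r → ε s ≤ 1)
    (hL : ∀ p, 1 ≤ p → p + 1 ≤ r →
      Linked n (i p) (j p) (ε p) (i (p + 1)) (j (p + 1)) (ε (p + 1)))
    (hN : ∀ p s, 1 ≤ p → p + 2 ≤ s → s ≤ r → i p ≤ i s ∧ i s < j s ∧ j s ≤ j p)
    (h2 : ∀ s, 1 ≤ s → s + 2 ≤ r → i s ≠ i (s + 2) ∧ j s ≠ j (s + 2)) :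
    IsPrimeSnake n r i j ε := by
  have hconn : ∀ p, 1 ≤ p → p + 1 ≤ r →
      ε p + ε (p + 1) = 1 ∧ i (p + 1 - ε p) < i (p + ε p) ∧ i (p + ε p) ≤ j (p + 1 - ε p) ∧
        j (p + 1 - ε p) < j (p + ε p) ∧ j (p + ε p) - i (p + 1 - ε p) ≤ (n : ℤ) + 1 := by
    intro p hp hpr
    rcases hL p hp hpr with h | h <;> rw [h.1, h.2.1] <;>
      simp only [Nat.sub_zero, Nat.add_zero, Nat.add_sub_cancel, true_and] <;> omega
  refine ⟨⟨⟨hI, hε, ?_, fun p hp hpr => ?_, hN⟩, fun p hp hpr => (hconn p hp hpr).2⟩, h2⟩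
  · rintro s p hs hsp hpr ⟨hi, hj⟩
    have hl := hL s hs (by omega)
    obtain rfl | rfl | rfl | h4 : p = s + 1 ∨ p = s + 2 ∨ p = s + 3 ∨ s + 4 ≤ p := by omega
    · rcases hl with h | h <;> omega
    · exact (h2 s hs hpr).1 hi
    · have := hN s (s + 2) hs le_rfl (by omega)
      have := h2 s hs (by omega)
      rcases hL (s + 2) (by omega) hpr with h | h <;> simp only [add_assoc, Nat.reduceAdd] at h <;>
        omega
    · have := hN s (s + 2) hs le_rfl (by omega)
      have := hN (s + 2) p (by omega) (by omega) hpr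
      have := h2 s hs (by omega)
      omega
  · obtain ⟨h1, h2, -, h3, -⟩ := hconn p hp hpr
    exact ⟨h1, h2, h3⟩

/-- A window of a prime snake is prime. -/
theorem IsPrimeSnake.window {n r : ℕ} {i j : ℕ → ℤ} {ε : ℕ → ℕ} (h : IsPrimeSnake n r i j ε)
    (q r' : ℕ) (hq : q + r' ≤ r) :
    IsPrimeSnake n r' (fun t => i (t + q)) (fun t => j (t + q)) (fun t => ε (t + q)) := by
  refine .of_linked (fun s hs hsr => h.1.1.1 _ (by omega) (by omega))
    (fun s hs hsr => h.1.1.2.1 _ (by omega) (by omega)) (fun p hp hpr => ?_)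
    (fun p s hp hps hs => h.nested (by omega) (by omega) (by omega)) (fun s hs hsr => ?_)
  · have := h.linked (p := p + q) (by omega) (by omega)
    rwa [show p + q + 1 = p + 1 + q by omega] at this
  · have := h.2 (s + q) (by omega) (by omega)
    rwa [show s + q + 2 = s + 2 + q by omega] at this

/-- Replacing the first two intervals `[i₁,j₁]`, `[i₂,j₂]` of a prime snake by their intersection
gives a prime snake, provided that `i₁ ≠ i₄` and `j₁ ≠ j₄`. -/
theorem IsPrimeSnake.merge_head {n r : ℕ} {i j i' j' : ℕ → ℤ} {ε ε' : ℕ → ℕ}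
    (h : IsPrimeSnake n (r + 1) i j ε) (hr : 2 ≤ r)
    (h4 : 3 ≤ r → i 1 ≠ i 4 ∧ j 1 ≠ j 4)
    (hi : i' 1 = i (1 + ε 1)) (hj : j' 1 = j (2 - ε 1))
    (hi' : ∀ t, 2 ≤ t → t ≤ r → i' t = i (t + 1)) (hj' : ∀ t, 2 ≤ t → t ≤ r → j' t = j (t + 1))
    (hε' : ∀ t, 1 ≤ t → t ≤ r → ε' t = ε (t + 1)) :
    IsPrimeSnake n r i' j' ε' := by
  have l1 := h.linked (p := 1) le_rfl (by omega)
  have l2 := h.linked (p := 2) (by omega) (by omega)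
  have n1 := h.nested_two (p := 1) le_rfl (by omega)
  simp only [Nat.reduceAdd] at l1 l2 n1
  have hX : (ε 1 = 0 ∧ i' 1 = i 1 ∧ j' 1 = j 2) ∨ (ε 1 = 1 ∧ i' 1 = i 2 ∧ j' 1 = j 1) := by
    rcases l1 with l | l <;> simp [hi, hj, l.1]
  have ipos := h.1.1.1
  unfold Linked at l1 l2
  unfold InIntv at ipos
  have i1 := ipos 1 le_rfl (by omega)
  have i2 := ipos 2 (by omega) (by omega)
  refine .of_linked (fun s hs hsr => ?_) (fun s hs hsr => ?_) (fun p hp hpr => ?_)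
    (fun p s hp hps hs => ?_) (fun s hs hsr => ?_)
  · obtain rfl | hs : s = 1 ∨ 2 ≤ s := by omega
    · unfold InIntv
      omega
    · rw [hi' s hs hsr, hj' s hs hsr]
      exact ipos _ (by omega) (by omega)
  · rw [hε' s hs hsr]
    exact h.1.1.2.1 _ (by omega) (by omega)
  · rw [hi' _ (by omega) hpr, hj' _ (by omega) hpr, hε' _ hp (by omega), hε' _ (by omega) hpr]
    obtain rfl | hp : p = 1 ∨ 2 ≤ p := by omega
    · simp only [Nat.reduceAdd]
      unfold Linked
      omega
    · rw [hi' _ hp (by omega), hj' _ hp (by omega)]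
      exact h.linked (by omega) (by omega)
  · rw [hi' s (by omega) hs, hj' s (by omega) hs]
    obtain rfl | hp : p = 1 ∨ 2 ≤ p := by omega
    · have := h.nested (p := 1) (s := s + 1) le_rfl (by omega) (by omega)
      have := h.nested (p := 2) (s := s + 1) (by omega) (by omega) (by omega)
      omega
    · rw [hi' _ hp (by omega), hj' _ hp (by omega)]
      exact h.nested (by omega) (by omega) (by omega)
  · rw [hi' _ (by omega) hsr, hj' _ (by omega) hsr]
    obtain rfl | hs : s = 1 ∨ 2 ≤ s := by omega
    · have := h4 hsr
      have := h.2 2 (by omega) (by omega)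
      simp only [Nat.reduceAdd] at this ⊢
      omega
    · rw [hi' _ hs (by omega), hj' _ hs (by omega)]
      exact h.2 _ (by omega) (by omega)

/-- Replacing the last two intervals of a prime snake of length `m + 2` by their union gives a
prime snake, provided that `i (m - 1) ≠ i (m + 2)` and `j (m - 1) ≠ j (m + 2)`. -/
theorem IsPrimeSnake.merge_tail {n m : ℕ} {i j i' j' : ℕ → ℤ} {ε ε' : ℕ → ℕ}
    (h : IsPrimeSnake n (m + 2) i j ε) (hm : 1 ≤ m)
    (h4 : 2 ≤ m → i (m - 1) ≠ i (m + 2) ∧ j (m - 1) ≠ j (m + 2))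
    (hi : i' (m + 1) = i (m + 1 + ε m)) (hj : j' (m + 1) = j (m + 2 - ε m))
    (hi' : ∀ t, 1 ≤ t → t ≤ m → i' t = i t) (hj' : ∀ t, 1 ≤ t → t ≤ m → j' t = j t)
    (hε' : ∀ t, 1 ≤ t → t ≤ m + 1 → ε' t = ε t) :
    IsPrimeSnake n (m + 1) i' j' ε' := by
  have l1 := h.linked (p := m) hm (by omega)
  have l2 := h.linked (p := m + 1) (by omega) (by omega)
  have n1 := h.nested_two (p := m) hm (by omega)
  simp only [add_assoc, Nat.reduceAdd] at l1 l2 n1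
  have hX : (ε m = 0 ∧ i' (m + 1) = i (m + 1) ∧ j' (m + 1) = j (m + 2)) ∨
      (ε m = 1 ∧ i' (m + 1) = i (m + 2) ∧ j' (m + 1) = j (m + 1)) := by
    rcases l1 with l | l <;> simp [hi, hj, l.1]
  have ipos := h.1.1.1
  unfold Linked at l1 l2
  unfold InIntv at ipos
  have i1 := ipos (m + 1) (by omega) (by omega)
  have i2 := ipos (m + 2) (by omega) (by omega)
  refine .of_linked (fun s hs hsr => ?_) (fun s hs hsr => ?_) (fun p hp hpr => ?_)
    (fun p s hp hps hs => ?_) (fun s hs hsr => ?_)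
  · obtain rfl | hsm : s = m + 1 ∨ s ≤ m := by omega
    · unfold InIntv
      omega
    · rw [hi' s hs hsm, hj' s hs hsm]
      exact ipos _ (by omega) (by omega)
  · rw [hε' s hs hsr]
    exact h.1.1.2.1 _ (by omega) (by omega)
  · rw [hi' _ hp (by omega), hj' _ hp (by omega), hε' _ hp (by omega), hε' _ (by omega) hpr]
    obtain rfl | hpm : p = m ∨ p + 1 ≤ m := by omega
    · unfold Linked
      omega
    · rw [hi' _ (by omega) hpm, hj' _ (by omega) hpm]
      exact h.linked (by omega) (by omega)
  · rw [hi' p hp (by omega), hj' p hp (by omega)]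
    obtain rfl | hsm : s = m + 1 ∨ s ≤ m := by omega
    · have := h.nested (p := p) (s := m + 1) hp (by omega) (by omega)
      have := h.nested (p := p) (s := m + 2) hp (by omega) (by omega)
      omega
    · rw [hi' s (by omega) hsm, hj' s (by omega) hsm]
      exact h.nested (by omega) (by omega) (by omega)
  · rw [hi' s hs (by omega), hj' s hs (by omega)]
    obtain rfl | hsm : m = s + 1 ∨ s + 2 ≤ m := by omega
    · have := h4 (by omega)
      have := h.2 s hs (by omega)
      simp only [add_assoc, Nat.reduceAdd, Nat.add_sub_cancel] at *
      omega
    · rw [hi' _ (by omega) hsm, hj' _ (by omega) hsm]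
      exact h.2 _ hs (by omega)

/-- The snakes `𝐬_{1,0}(p,ℓ+1)`, `𝐬_{0,1}(p,ℓ+1)` and `𝐬_{1,1}(p,ℓ+1)` are prime
elements of `𝐒ˢ` under the appropriate hypotheses. -/
theorem stmt6 (n r : ℕ) (hn : 1 ≤ n) (i j : ℕ → ℤ) (ε : ℕ → ℕ)
    (hp : IsPrimeSnake n r i j ε) (p ℓ : ℕ) (hpl : p + 1 < ℓ) (hlr : ℓ ≤ r) :
    ((1 ≤ p ∧ p + 3 ≤ r ∧ i p ≠ i (p + 3) ∧ j p ≠ j (p + 3)) →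
      IsPrimeSnake n (ℓ - p)
        (fun t => if t = 1 then i (p + ε p) else i (t + p))
        (fun t => if t = 1 then j (p + 1 - ε p) else j (t + p))
        (fun t => ε (t + p))) ∧
    ((2 ≤ ℓ ∧ ℓ + 2 ≤ r ∧ i (ℓ - 1) ≠ i (ℓ + 2) ∧ j (ℓ - 1) ≠ j (ℓ + 2)) →
      IsPrimeSnake n (ℓ - p)
        (fun t => if t + p + 1 ≤ ℓ then i (t + p + 1) else i (ℓ + 1 + ε ℓ))
        (fun t => if t + p + 1 ≤ ℓ then j (t + p + 1) else j (ℓ + 2 - ε ℓ))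
        (fun t => ε (t + p + 1))) ∧
    ((1 ≤ p ∧ p + 3 ≤ r ∧ i p ≠ i (p + 3) ∧ j p ≠ j (p + 3) ∧
      2 ≤ ℓ ∧ ℓ + 2 ≤ r ∧ i (ℓ - 1) ≠ i (ℓ + 2) ∧ j (ℓ - 1) ≠ j (ℓ + 2)) →
      IsPrimeSnake n (ℓ - p + 1)
        (fun t => if t = 1 then i (p + ε p) else if t + p ≤ ℓ then i (t + p)
          else i (ℓ + 1 + ε ℓ))
        (fun t => if t = 1 then j (p + 1 - ε p) else if t + p ≤ ℓ then j (t + p)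
          else j (ℓ + 2 - ε ℓ))
        (fun t => ε (t + p))) := by
  have head : ∀ m, ℓ ≤ m → m ≤ r → (1 ≤ p ∧ p + 3 ≤ r ∧ i p ≠ i (p + 3) ∧ j p ≠ j (p + 3)) →
      IsPrimeSnake n (m - p)
        (fun t => if t = 1 then i (p + ε p) else i (t + p))
        (fun t => if t = 1 then j (p + 1 - ε p) else j (t + p))
        (fun t => ε (t + p)) := by
    rintro m hm hmr ⟨h1, -, hi, hj⟩
    obtain ⟨q, rfl⟩ : ∃ q, p = q + 1 := ⟨p - 1, by omega⟩
    refine (hp.window q (m - (q + 1) + 1) (by omega)).merge_head (by omega) (fun _ => ?_) ?_ ?_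
      (fun t ht _ => ?_) (fun t ht _ => ?_) (fun t _ _ => ?_)
    · rw [show 1 + q = q + 1 by omega, show 4 + q = q + 1 + 3 by omega]
      exact ⟨hi, hj⟩
    · simp only [if_true]
      congr 1
      rw [add_comm 1 q]
      omega
    · have := hp.1.1.2.1 (q + 1) (by omega) (by omega)
      simp only [if_true]
      congr 1
      rw [add_comm 1 q]
      omega
    · simp only [if_neg (show t ≠ 1 by omega)]
      congr 1
      omega
    · simp only [if_neg (show t ≠ 1 by omega)]
      congr 1
      omega
    · congr 1
      omega
  refine ⟨head ℓ le_rfl hlr, ?_, ?_⟩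
  · rintro ⟨-, hl, hi, hj⟩
    obtain ⟨m, rfl⟩ : ∃ m, ℓ = m + 1 + (p + 1) := ⟨ℓ - p - 2, by omega⟩
    rw [show m + 1 + (p + 1) - p = m + 1 + 1 by omega]
    refine (hp.window (p + 1) (m + 1 + 2) (by omega)).merge_tail (by omega) (fun _ => ?_) ?_ ?_
      (fun t ht htm => ?_) (fun t ht htm => ?_) (fun t _ _ => rfl)
    · rw [show m + 1 - 1 + (p + 1) = m + 1 + (p + 1) - 1 by omega,
        show m + 1 + 2 + (p + 1) = m + 1 + (p + 1) + 2 by omega]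
      exact ⟨hi, hj⟩
    · rw [if_neg (by omega)]
      congr 1
      omega
    · have := hp.1.1.2.1 (m + 1 + (p + 1)) (by omega) (by omega)
      rw [if_neg (by omega)]
      congr 1
      omega
    · exact if_pos (by omega)
    · exact if_pos (by omega)
  · rintro ⟨h1, h3, hip, hjp, -, hl, hi, hj⟩
    have hh := head (ℓ + 2) (by omega) hl ⟨h1, h3, hip, hjp⟩
    obtain ⟨m, rfl⟩ : ∃ m, ℓ = m + 2 + p := ⟨ℓ - p - 2, by omega⟩
    rw [show m + 2 + p + 2 - p = m + 2 + 2 by omega] at hh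
    rw [show m + 2 + p - p + 1 = m + 2 + 1 by omega]
    refine hh.merge_tail (by omega) (fun _ => ?_) ?_ ?_
      (fun t ht htm => ?_) (fun t ht htm => ?_) (fun t _ _ => rfl)
    · obtain rfl | hm : m = 0 ∨ 1 ≤ m := by omega
      · have l := hp.linked h1 (by omega)
        have n1 := hp.nested_two (p := p) h1 (by omega)
        have n3 := hp.nested_two (p := p + 2) (by omega) (by omega)
        rw [show 0 + 2 + p - 1 = p + 1 by omega, show 0 + 2 + p + 2 = p + 4 by omega] at hi hj
        simp only [Nat.zero_add, Nat.reduceAdd, Nat.reduceSub, if_true,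
          show (4 : ℕ) ≠ 1 by omega, if_false, add_assoc, add_comm 4 p] at *
        rcases l with l | l <;> rw [l.1] <;> simp only [Nat.sub_zero, Nat.add_zero,
          Nat.add_sub_cancel] <;> omega
      · simp only [if_neg (show m + 2 - 1 ≠ 1 by omega), if_neg (show m + 2 + 2 ≠ 1 by omega)]
        rw [show m + 2 - 1 + p = m + 2 + p - 1 by omega,
          show m + 2 + 2 + p = m + 2 + p + 2 by omega]
        exact ⟨hi, hj⟩
    · rw [if_neg (by omega), if_neg (by omega), if_neg (by omega)]
      congr 1
      omega
    · have := hp.1.1.2.1 (m + 2 + p) (by omega) (by omega)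
      rw [if_neg (by omega), if_neg (by omega), if_neg (by omega)]
      congr 1
      omega
    · simp only [if_pos (show t + p ≤ m + 2 + p by omega)]
    · simp only [if_pos (show t + p ≤ m + 2 + p by omega)]
end

section
/- Let 𝐬 = ([i_1,j_1],…,[i_r,j_r]) ∈ 𝐒ˢ ∩ 𝕀_n^r be prime with r ≥ 3, and suppose j_min = i_max and j_max − i_min = n+1. Let N = N(𝐬), ξ = ξ_𝐬, s_m = p_{r−m+1}, and define i'_{s_m} = (ξ(s_m) − s_m)/2 − ε_m and j'_{s_m} = (ξ(s_m) + s_m)/2 − ε_m for 1 ≤ m ≤ r. Then 𝐬_ξ = ([i'_{s_1}, j'_{s_1}],…,[i'_{s_r}, j'_{s_r}]), with signs ε_1,…,ε_r, is a prime element of 𝐒ˢ ∩ 𝕀_N^r; moreover (1) for 2 ≤ m ≤ r−2, i_{m−1} = i_{m+2} if and only if i'_{s_{m−1}} = i'_{s_{m+2}}, and j_{m−1} = j_{m+2} if and only if j'_{s_{m−1}} = j'_{s_{m+2}}; and (2) for all 1 ≤ m, ℓ ≤ r, [i_m, j_ℓ] ∈ 𝕀_n(𝐬) if and only if [i'_{s_m},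 j'_{s_ℓ}] ∈ 𝕀_N(𝐬_ξ). -/
/-- Membership of the interval `[a,b]` in `Ĩₙ(𝐬)`. -/
def ItildeMem (n r : ℕ) (i j : ℕ → ℤ) (ε : ℕ → ℕ) (a b : ℤ) : Prop :=
  InIntv n a b ∧
  ∃ p ℓ, 1 ≤ p ∧ p ≤ r ∧ 1 ≤ ℓ ∧ ℓ ≤ r ∧
    (ℓ + 1 + ε p = p ∨ ℓ + ε p = p ∨ ℓ + ε p = p + 1 ∨ ℓ + ε p = p + 2) ∧
    a = i p ∧ b = j ℓ

/-- Membership of the interval `[a,b]` in `𝕀ₙ(𝐬)`. -/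
def IMem (n r : ℕ) (i j : ℕ → ℤ) (ε : ℕ → ℕ) (a b : ℤ) : Prop :=
  ItildeMem n r i j ε a b ∧ b ≠ a ∧ b ≠ a + (n : ℤ) + 1

/-- The intervals `[a,b]` and `[c,d]` form a connected pair. -/
def ConnPair (n : ℕ) (a b c d : ℤ) : Prop :=
  min a c < max a c ∧ max a c ≤ min b d ∧ min b d < max b d ∧
    max b d - min a c ≤ (n : ℤ) + 1

/-- `N(𝐬) = r + #{2 ≤ s ≤ r-2 : i (s-1) ≠ i (s+2) and j (s-1) ≠ j (s+2)}`. -/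
def Nval (r : ℕ) (i j : ℕ → ℤ) : ℕ :=
  r + ((Finset.Icc 2 (r - 2)).filter
    (fun s => i (s - 1) ≠ i (s + 2) ∧ j (s - 1) ≠ j (s + 2))).card

/-- The sequence `p_1, …, p_r` attached to a prime snake:
`p 1 = 1`, `p 2 = 2`, `p r = p (r-1) + 1`, and for `2 ≤ m ≤ r-2`,
`p (m+1) = p m + 2` if `i (r-m+2) ≠ i (r-m-1)` and `j (r-m+2) ≠ j (r-m-1)`,
and `p (m+1) = p m + 1` otherwise. -/
def pSeq (r : ℕ) (i j : ℕ → ℤ) : ℕ → ℕ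
  | 0 => 0
  | 1 => 1
  | 2 => 2
  | m + 3 =>
    pSeq r i j (m + 2) +
      (if m + 3 = r then 1
       else if i (r - m) ≠ i (r - m - 3) ∧ j (r - m) ≠ j (r - m - 3) then 2 else 1)

/-- The defining conditions of the height function `ξ = ξ_𝐬 : {1,…,N} → ℤ`. -/
def HeightCond (r N : ℕ) (p ε : ℕ → ℕ) (ξ : ℕ → ℤ) : Prop :=
  (∀ t, 1 ≤ t → t + 1 ≤ N → |ξ (t + 1) - ξ t| ≤ 1) ∧
  ξ (p r) = (p r : ℤ) ∧
  (∀ m, 1 ≤ m → m ≤ r → 2 ≤ p m → p m + 1 ≤ N → ξ (p m - 1) = ξ (p m + 1)) ∧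
  (∀ m, 1 ≤ m → m + 1 ≤ r →
    ξ (p (m + 1 - ε (r - m))) - ξ (p (m + ε (r - m))) = (p (m + 1) : ℤ) - (p m : ℤ))

/-- `s_m = p_{r-m+1}`. -/
def sIdx (r : ℕ) (i j : ℕ → ℤ) (m : ℕ) : ℕ := pSeq r i j (r - m + 1)

/-- `i'_{s_m} = (ξ(s_m) - s_m)/2 - ε_m`. -/
def iPr (r : ℕ) (i j : ℕ → ℤ) (ε : ℕ → ℕ) (ξ : ℕ → ℤ) (m : ℕ) : ℤ :=
  (ξ (sIdx r i j m) - (sIdx r i j m : ℤ)) / 2 - (ε m : ℤ)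

/-- `j'_{s_m} = (ξ(s_m) + s_m)/2 - ε_m`. -/
def jPr (r : ℕ) (i j : ℕ → ℤ) (ε : ℕ → ℕ) (ξ : ℕ → ℤ) (m : ℕ) : ℤ :=
  (ξ (sIdx r i j m) + (sIdx r i j m : ℤ)) / 2 - (ε m : ℤ)

lemma pSeq_succ_of_interior {r : ℕ} (i j : ℕ → ℤ) {m : ℕ} (h2 : 2 ≤ m) (hm : m + 2 ≤ r) :
    pSeq r i j (r - m + 1) = pSeq r i j (r - m) +
      (if i (m + 2) ≠ i (m - 1) ∧ j (m + 2) ≠ j (m - 1) then 2 else 1) := by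
  obtain ⟨k, rfl⟩ : ∃ k, r = k + (m + 2) := ⟨r - (m + 2), by omega⟩
  have e1 : k + (m + 2) - m + 1 = k + 3 := by omega
  have e2 : k + (m + 2) - m = k + 2 := by omega
  have e3 : k + (m + 2) - k = m + 2 := by omega
  have e4 : k + (m + 2) - k - 3 = m - 1 := by omega
  rw [e1, e2, pSeq, e4, e3, if_neg (by omega)]

lemma pSeq_last {r : ℕ} (hr : 3 ≤ r) (i j : ℕ → ℤ) :
    pSeq r i j r = pSeq r i j (r - 1) + 1 := by
  obtain ⟨k, rfl⟩ : ∃ k, r = k + 3 := ⟨r - 3, by omega⟩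
  simp [pSeq]

lemma pSeq_eq_add_card {r : ℕ} (i j : ℕ → ℤ) (k : ℕ) (hk : k + 3 ≤ r) :
    pSeq r i j (k + 2) = k + 2 + ((Finset.Icc (r - (k + 1)) (r - 2)).filter
      (fun s => i (s - 1) ≠ i (s + 2) ∧ j (s - 1) ≠ j (s + 2))).card := by
  induction k with
  | zero =>
    rw [Finset.Icc_eq_empty (by omega)]
    simp [pSeq]
  | succ k ih =>
    have h := pSeq_succ_of_interior (r := r) i j (m := r - (k + 2)) (by omega) (by omega)
    have e1 : r - (r - (k + 2)) = k + 2 := by omega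
    have e2 : r - (k + 1) = r - (k + 2) + 1 := by omega
    rw [e1, ih (by omega), e2] at h
    rw [show k + 1 + 2 = k + 2 + 1 from rfl, h, show k + 1 + 1 = k + 2 from rfl,
      ← Finset.insert_Icc_add_one_left_eq_Icc (show r - (k + 2) ≤ r - 2 by omega),
      Finset.filter_insert]
    simp only [ne_comm (a := i (r - (k + 2) - 1)), ne_comm (a := j (r - (k + 2) - 1))]
    split_ifs
    · rw [Finset.card_insert_of_notMem (by simp)]
      omega
    · omega

lemma pSeq_eq_Nval {r : ℕ} (hr : 3 ≤ r) (i j : ℕ → ℤ) : pSeq r i j r = Nval r i j := by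
  have h := pSeq_eq_add_card (r := r) i j (r - 3) (by omega)
  rw [show r - 3 + 2 = r - 1 by omega, show r - (r - 3 + 1) = 2 by omega] at h
  rw [pSeq_last hr, h, Nval]
  omega

lemma sIdx_first {r : ℕ} (hr : 3 ≤ r) (i j : ℕ → ℤ) : sIdx r i j 1 = Nval r i j := by
  rw [sIdx, show r - 1 + 1 = r by omega, pSeq_eq_Nval hr]

lemma sIdx_last (r : ℕ) (i j : ℕ → ℤ) : sIdx r i j r = 1 := by
  simp [sIdx, pSeq]

lemma sIdx_of_interior {r : ℕ} (i j : ℕ → ℤ) {m : ℕ} (h2 : 2 ≤ m) (hm : m + 2 ≤ r) :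
    sIdx r i j m = sIdx r i j (m + 1) +
      (if i (m + 2) ≠ i (m - 1) ∧ j (m + 2) ≠ j (m - 1) then 2 else 1) := by
  rw [sIdx, sIdx, show r - (m + 1) + 1 = r - m by omega]
  exact pSeq_succ_of_interior i j h2 hm

lemma sIdx_succ_lt {r : ℕ} (hr : 3 ≤ r) (i j : ℕ → ℤ) {m : ℕ} (h1 : 1 ≤ m) (hm : m + 1 ≤ r) :
    sIdx r i j (m + 1) < sIdx r i j m := by
  rcases Nat.lt_or_ge m 2 with h2 | h2
  · obtain rfl : m = 1 := by omega
    rw [sIdx, sIdx, show r - (1 + 1) + 1 = r - 1 by omega, show r - 1 + 1 = r by omega,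
      pSeq_last hr]
    omega
  rcases Nat.lt_or_ge r (m + 2) with h3 | h3
  · obtain rfl : r = m + 1 := by omega
    rw [sIdx, sIdx, show m + 1 - (m + 1) + 1 = 1 by omega, show m + 1 - m + 1 = 2 by omega]
    simp [pSeq]
  · rw [sIdx_of_interior i j h2 h3]
    split_ifs <;> omega

lemma sIdx_lt_of_lt {r : ℕ} (hr : 3 ≤ r) (i j : ℕ → ℤ) {m l : ℕ} (h1 : 1 ≤ m) (hml : m < l)
    (hl : l ≤ r) : sIdx r i j l < sIdx r i j m := by
  induction l, hml using Nat.le_induction with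
  | base => exact sIdx_succ_lt hr i j h1 hl
  | succ l hml ih =>
    exact (sIdx_succ_lt hr i j (by omega) hl).trans (ih (by omega))

lemma jPr_sub_iPr (r : ℕ) (i j : ℕ → ℤ) (ε : ℕ → ℕ) (ξ : ℕ → ℤ) (m : ℕ) :
    jPr r i j ε ξ m - iPr r i j ε ξ m = sIdx r i j m := by
  simp only [jPr, iPr]
  omega

/-- How the endpoints of consecutive intervals of `𝐬_ξ` differ, according to the sign. -/
lemma HeightCond.step {r N : ℕ} {i j : ℕ → ℤ} {ε : ℕ → ℕ} {ξ : ℕ → ℤ}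
    (hξ : HeightCond r N (pSeq r i j) ε ξ) {m : ℕ} (h1 : 1 ≤ m) (hm : m + 1 ≤ r)
    (hε : ε m + ε (m + 1) = 1) :
    (ε m = 0 → iPr r i j ε ξ m = iPr r i j ε ξ (m + 1) + 1 ∧
      jPr r i j ε ξ m = jPr r i j ε ξ (m + 1) + (sIdx r i j m - sIdx r i j (m + 1)) + 1) ∧
    (ε m = 1 → iPr r i j ε ξ (m + 1) =
        iPr r i j ε ξ m + (sIdx r i j m - sIdx r i j (m + 1)) + 1 ∧
      jPr r i j ε ξ (m + 1) = jPr r i j ε ξ m + 1) := by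
  have h := hξ.2.2.2 (r - m) (by omega) (by omega)
  have e : r - (m + 1) + 1 = r - m := by omega
  rw [show r - (r - m) = m by omega] at h
  refine ⟨fun h0 => ?_, fun h0 => ?_⟩
  · simp only [iPr, jPr, sIdx, e]
    simp only [h0, Nat.sub_zero, Nat.add_zero] at h
    omega
  · simp only [iPr, jPr, sIdx, e]
    rw [h0, Nat.add_sub_cancel] at h
    omega

lemma le_of_two_three_steps {r : ℕ} {f : ℕ → ℤ}
    (h2 : ∀ p, 1 ≤ p → p + 2 ≤ r → f p ≤ f (p + 2))
    (h3 : ∀ p, 1 ≤ p → p + 3 ≤ r → f p ≤ f (p + 3))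
    (p s : ℕ) (hp : 1 ≤ p) (hps : p + 2 ≤ s) (hs : s ≤ r) : f p ≤ f s := by
  obtain ⟨k, rfl⟩ := Nat.exists_eq_add_of_le hps
  induction k using Nat.twoStepInduction with
  | zero => exact h2 p hp hs
  | one => exact h3 p hp hs
  | more k ih _ => exact (ih (by omega) (by omega)).trans (h2 _ (by omega) hs)

section PrimeSnake

variable {n r : ℕ} {i j : ℕ → ℤ} {ε : ℕ → ℕ}

lemma IsPrimeSnake.sign (hp : IsPrimeSnake n r i j ε) {p : ℕ} (h1 : 1 ≤ p) (h : p + 1 ≤ r) :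
    ε p = 0 ∧ ε (p + 1) = 1 ∧ i (p + 1) < i p ∧ j (p + 1) < j p ∨
    ε p = 1 ∧ ε (p + 1) = 0 ∧ i p < i (p + 1) ∧ j p < j (p + 1) := by
  obtain ⟨hs, hi, hj⟩ := hp.1.1.2.2.2.1 p h1 h
  rcases (by omega : ε p = 0 ∨ ε p = 1) with h0 | h0
  · rw [h0] at hi hj
    exact Or.inl ⟨h0, by omega, hi, hj⟩
  · rw [h0, Nat.add_sub_cancel] at hi hj
    exact Or.inr ⟨h0, by omega, hi, hj⟩

lemma IsPrimeSnake.lt_add_two (hp : IsPrimeSnake n r i j ε) {p : ℕ} (h1 : 1 ≤ p)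
    (h : p + 2 ≤ r) : i p < i (p + 2) ∧ j (p + 2) < j p := by
  have hc := hp.1.1.2.2.2.2 p (p + 2) h1 le_rfl h
  have hn := hp.2 p h1 h
  omega

/-- Distinct positions of a prime snake share an endpoint only at distance three. -/
lemma IsPrimeSnake.eq_add_three (hp : IsPrimeSnake n r i j ε) {p q : ℕ} (h1 : 1 ≤ p)
    (hpq : p < q) (hq : q ≤ r) (he : i p = i q ∨ j p = j q) : q = p + 3 := by
  by_contra hne
  rcases (by omega : q = p + 1 ∨ q = p + 2 ∨ p + 4 ≤ q) with rfl | rfl | h4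
  · have := hp.sign h1 hq
    omega
  · have := hp.lt_add_two h1 hq
    omega
  · have h := hp.lt_add_two h1 (by omega)
    have h' := hp.1.1.2.2.2.2 (p + 2) q (by omega) (by omega) hq
    omega

/-- The positions where a prime snake attains its extremal endpoints. -/
lemma IsPrimeSnake.extremal (hp : IsPrimeSnake n r i j ε) (hr : 3 ≤ r) {q : ℕ} (h1 : 1 ≤ q)
    (hq : q ≤ r) :
    i (2 - ε 1) ≤ i q ∧ j q ≤ j (1 + ε 1) ∧
    i q ≤ i (r - 1 + ε (r - 1)) ∧ j (r - ε (r - 1)) ≤ j q := by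
  have hc := hp.1.1.2.2.2.2
  have hfirst : i (2 - ε 1) ≤ i q ∧ j q ≤ j (1 + ε 1) := by
    have hs := hp.sign (p := 1) le_rfl (by omega)
    rcases (by omega : q = 1 ∨ q = 2 ∨ 3 ≤ q) with rfl | rfl | h3
    · rcases hs with ⟨h0, h⟩ | ⟨h0, h⟩ <;> rw [h0] <;> norm_num at h ⊢ <;> omega
    · rcases hs with ⟨h0, h⟩ | ⟨h0, h⟩ <;> rw [h0] <;> norm_num at h ⊢ <;> omega
    · have := hc 1 q le_rfl (by omega) hq
      rcases hs with ⟨h0, h⟩ | ⟨h0, h⟩ <;> rw [h0] <;> norm_num at h ⊢ <;> omega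
  have hlast : i q ≤ i (r - 1 + ε (r - 1)) ∧ j (r - ε (r - 1)) ≤ j q := by
    obtain ⟨k, rfl⟩ : ∃ k, r = k + 1 := ⟨r - 1, by omega⟩
    rw [Nat.add_sub_cancel]
    have hs := hp.sign (p := k) (by omega) le_rfl
    rcases (by omega : q = k ∨ q = k + 1 ∨ q + 2 ≤ k + 1) with rfl | rfl | h3
    · rcases hs with ⟨h0, h⟩ | ⟨h0, h⟩ <;> rw [h0] <;> norm_num at h ⊢ <;> omega
    · rcases hs with ⟨h0, h⟩ | ⟨h0, h⟩ <;> rw [h0] <;> norm_num at h ⊢ <;> omega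
    · have := hc q (k + 1) h1 h3 le_rfl
      rcases hs with ⟨h0, h⟩ | ⟨h0, h⟩ <;> rw [h0] <;> norm_num at h ⊢ <;> omega
  exact ⟨hfirst.1, hfirst.2, hlast.1, hlast.2⟩

/-- For a prime snake of full width whose extremal endpoints touch, membership in `𝕀ₙ(𝐬)` only
depends on which endpoints coincide. -/
lemma IsPrimeSnake.iMem_iff (hp : IsPrimeSnake n r i j ε) (hr : 3 ≤ r)
    (htouch : j (r - ε (r - 1)) = i (r - 1 + ε (r - 1)))
    (hwidth : j (1 + ε 1) - i (2 - ε 1) = (n : ℤ) + 1)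
    {m l : ℕ} (hm1 : 1 ≤ m) (hm : m ≤ r) (hl1 : 1 ≤ l) (hl : l ≤ r) :
    IMem n r i j ε (i m) (j l) ↔
      (∃ p q, 1 ≤ p ∧ p ≤ r ∧ 1 ≤ q ∧ q ≤ r ∧
        (q + 1 + ε p = p ∨ q + ε p = p ∨ q + ε p = p + 1 ∨ q + ε p = p + 2) ∧
        i m = i p ∧ j l = j q) ∧
      ¬(i m = i (r - 1 + ε (r - 1)) ∧ j l = j (r - ε (r - 1))) ∧
      ¬(i m = i (2 - ε 1) ∧ j l = j (1 + ε 1)) := by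
  have hi := hp.extremal hr hm1 hm
  have hj := hp.extremal hr hl1 hl
  have hin : InIntv n (i m) (j l) := by
    constructor <;> omega
  rw [IMem, ItildeMem, and_assoc, and_iff_right hin]
  refine and_congr_right fun _ => and_congr (not_congr ?_) (not_congr ?_) <;> omega

end PrimeSnake

/-- Two sequences whose values only coincide at distance three, and do so at the same places,
have the same pattern of equal values. -/
lemma eq_iff_eq_of_eq_add_three {r : ℕ} {f g : ℕ → ℤ}
    (hf : ∀ p q, 1 ≤ p → p < q → q ≤ r → f p = f q → q = p + 3)
    (hg : ∀ p q, 1 ≤ p → p < q → q ≤ r → g p = g q → q = p + 3)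
    (hfg : ∀ p, 1 ≤ p → p + 3 ≤ r → (f p = f (p + 3) ↔ g p = g (p + 3)))
    {p q : ℕ} (hp1 : 1 ≤ p) (hp : p ≤ r) (hq1 : 1 ≤ q) (hq : q ≤ r) :
    f p = f q ↔ g p = g q := by
  have key : ∀ p q, 1 ≤ p → p < q → q ≤ r → (f p = f q ↔ g p = g q) := by
    intro p q h1 h h'
    by_cases hpq : q = p + 3
    · subst hpq
      exact hfg p h1 h'
    · exact ⟨fun he => absurd (hf p q h1 h h' he) hpq, fun he => absurd (hg p q h1 h h' he) hpq⟩
  rcases lt_trichotomy p q with h | rfl | h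
  · exact key p q hp1 h hq
  · simp
  · rw [eq_comm, key q p hq1 h hp, eq_comm]

section HeightSnake

variable {n r N : ℕ} {i j : ℕ → ℤ} {ε : ℕ → ℕ} {ξ : ℕ → ℤ}

lemma isPrimeSnake_height (hr : 3 ≤ r) (hp : IsPrimeSnake n r i j ε)
    (hξ : HeightCond r (Nval r i j) (pSeq r i j) ε ξ) :
    IsPrimeSnake (Nval r i j) r (iPr r i j ε ξ) (jPr r i j ε ξ) ε := by
  have hlen := jPr_sub_iPr r i j ε ξ
  have hlt : ∀ p, 1 ≤ p → p + 1 ≤ r → sIdx r i j (p + 1) < sIdx r i j p :=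
    fun p h1 h => sIdx_succ_lt hr i j h1 h
  have hpos : ∀ p, 1 ≤ p → p ≤ r → 1 ≤ sIdx r i j p ∧ sIdx r i j p ≤ Nval r i j := by
    intro p h1 h
    have hf := sIdx_first hr i j
    have hl := sIdx_last r i j
    refine ⟨hl ▸ ?_, hf ▸ ?_⟩
    · rcases h.eq_or_lt with rfl | h
      · exact le_rfl
      · exact (sIdx_lt_of_lt hr i j h1 h le_rfl).le
    · rcases h1.eq_or_lt with rfl | h1
      · exact le_rfl
      · exact (sIdx_lt_of_lt hr i j le_rfl h1 h).le
  have hdist : ∀ p s, 1 ≤ p → p < s → s ≤ r → sIdx r i j s < sIdx r i j p :=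
    fun p s => sIdx_lt_of_lt hr i j
  have hstep : ∀ p, 1 ≤ p → p + 1 ≤ r → _ := fun p h1 h =>
    hξ.step h1 h (hp.1.1.2.2.2.1 p h1 h).1
  generalize iPr r i j ε ξ = I at *
  generalize jPr r i j ε ξ = J at *
  generalize sIdx r i j = S at *
  have hε : ∀ p, 1 ≤ p → p + 1 ≤ r → ε p = 0 ∧ ε (p + 1) = 1 ∨ ε p = 1 ∧ ε (p + 1) = 0 :=
    fun p h1 h => by
      have := hp.sign h1 h
      omega
  have htwo : ∀ p, 1 ≤ p → p + 2 ≤ r → I p < I (p + 2) ∧ J (p + 2) < J p := by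
    intro p h1 h
    have a := hstep p h1 (by omega)
    have b := hstep (p + 1) (by omega) h
    have c := hε p h1 (by omega)
    have d := hlt p h1 (by omega)
    have e := hlt (p + 1) (by omega) h
    rw [show p + 1 + 1 = p + 2 from rfl] at *
    omega
  have hthree : ∀ p, 1 ≤ p → p + 3 ≤ r → I p ≤ I (p + 3) ∧ J (p + 3) ≤ J p := by
    intro p h1 h
    have a := hlt p h1 (by omega)
    have a' := hlt (p + 1) (by omega) (by omega)
    have a'' := hlt (p + 2) (by omega) (by omega)
    have b := hstep (p + 1) (by omega) (by omega)
    have c := hstep p h1 (by omega)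
    have d := hstep (p + 2) (by omega) (by omega)
    have e := hε p h1 (by omega)
    have f := hε (p + 1) (by omega) (by omega)
    rw [show p + 1 + 1 = p + 2 from rfl] at *
    rw [show p + 1 + 2 = p + 3 from rfl] at *
    rw [show p + 2 + 1 = p + 3 from rfl] at *
    omega
  have hconn : ∀ p, 1 ≤ p → p + 1 ≤ r →
      I (p + 1 - ε p) < I (p + ε p) ∧ I (p + ε p) ≤ J (p + 1 - ε p) ∧
      J (p + 1 - ε p) < J (p + ε p) ∧
      J (p + ε p) - I (p + 1 - ε p) ≤ (Nval r i j : ℤ) + 1 := by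
    intro p h1 h
    have a := hstep p h1 h
    have b := hlt p h1 h
    have c := hpos p h1 (by omega)
    have d := hpos (p + 1) (by omega) h
    have e := hlen p
    have f := hlen (p + 1)
    rcases hε p h1 h with ⟨h0, -⟩ | ⟨h0, -⟩
    · have := a.1 h0
      simp only [h0, Nat.sub_zero, Nat.add_zero]
      omega
    · have := a.2 h0
      rw [h0, Nat.add_sub_cancel]
      omega
  refine ⟨⟨⟨fun s h1 h => ?_, hp.1.1.2.1, fun s p h1 h h' he => ?_, fun p h1 h => ?_,
    fun p s h1 h h' => ⟨?_, ?_, ?_⟩⟩, hconn⟩, fun s h1 h => ?_⟩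
  · have := hlen s
    have := hpos s h1 h
    constructor <;> omega
  · have := hlen s
    have := hlen p
    have := hdist s p h1 h h'
    omega
  · exact ⟨(hp.1.1.2.2.2.1 p h1 h).1, (hconn p h1 h).1, (hconn p h1 h).2.2.1⟩
  · exact le_of_two_three_steps (fun p h1 h => (htwo p h1 h).1.le)
      (fun p h1 h => (hthree p h1 h).1) p s h1 h h'
  · have := hlen s
    have := hpos s (by omega) h'
    omega
  · have := le_of_two_three_steps (f := fun p => -J p)
      (fun p h1 h => neg_le_neg (htwo p h1 h).2.le)
      (fun p h1 h => neg_le_neg (hthree p h1 h).2) p s h1 h h'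
    exact neg_le_neg_iff.mp this
  · have := htwo s h1 h
    omega

/-- The snake `𝐬_ξ` has the same coincidences at distance three as `𝐬`. -/
lemma height_eq_add_three_iff (hp : IsPrimeSnake n r i j ε)
    (hξ : HeightCond r N (pSeq r i j) ε ξ) {p : ℕ} (h1 : 1 ≤ p) (h : p + 3 ≤ r) :
    (i p = i (p + 3) ↔ iPr r i j ε ξ p = iPr r i j ε ξ (p + 3)) ∧
    (j p = j (p + 3) ↔ jPr r i j ε ξ p = jPr r i j ε ξ (p + 3)) := by
  have hε := fun q h1 h => (hp.1.1.2.2.2.1 q h1 h).1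
  have a := hξ.step h1 (by omega) (hε p h1 (by omega))
  have b := hξ.step (m := p + 1) (by omega) (by omega) (hε _ (by omega) (by omega))
  have c := hξ.step (m := p + 2) (by omega) (by omega) (hε _ (by omega) (by omega))
  have hr : 3 ≤ r := by omega
  have l0 := sIdx_succ_lt hr i j h1 (by omega)
  have l2 := sIdx_succ_lt (m := p + 2) hr i j (by omega) (by omega)
  have d := sIdx_of_interior (r := r) i j (m := p + 1) (by omega) (by omega)
  have s0 := hp.sign h1 (by omega)
  have s2 := hp.sign (p := p + 2) (by omega) (by omega)
  have t0 := hp.lt_add_two h1 (by omega)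
  have t1 := hp.lt_add_two (p := p + 1) (by omega) (by omega)
  have s1 := hp.sign (p := p + 1) (by omega) (by omega)
  simp only [Nat.add_assoc, Nat.reduceAdd, Nat.add_sub_cancel] at *
  split_ifs at d <;> omega

end HeightSnake

/-- `𝐬_ξ` is a prime element of `𝐒ˢ ∩ 𝕀_N^r` and the pair `(𝐬, 𝐬_ξ)` satisfies
the compatibility conditions for an isomorphism of Grothendieck rings. -/
theorem stmt16 (n r : ℕ) (hn : 1 ≤ n) (hr : 3 ≤ r) (i j : ℕ → ℤ) (ε : ℕ → ℕ)
    (hp : IsPrimeSnake n r i j ε)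
    (imin imax jmin jmax : ℤ)
    (himin : IsLeast {x | ∃ s, 1 ≤ s ∧ s ≤ r ∧ x = i s} imin)
    (himax : IsGreatest {x | ∃ s, 1 ≤ s ∧ s ≤ r ∧ x = i s} imax)
    (hjmin : IsLeast {x | ∃ s, 1 ≤ s ∧ s ≤ r ∧ x = j s} jmin)
    (hjmax : IsGreatest {x | ∃ s, 1 ≤ s ∧ s ≤ r ∧ x = j s} jmax)
    (h1 : jmin = imax) (h2 : jmax - imin = (n : ℤ) + 1)
    (ξ : ℕ → ℤ) (hξ : HeightCond r (Nval r i j) (pSeq r i j) ε ξ) :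
    IsPrimeSnake (Nval r i j) r (iPr r i j ε ξ) (jPr r i j ε ξ) ε ∧
    (∀ m, 2 ≤ m → m + 2 ≤ r →
      ((i (m - 1) = i (m + 2)) ↔ (iPr r i j ε ξ (m - 1) = iPr r i j ε ξ (m + 2))) ∧
      ((j (m - 1) = j (m + 2)) ↔ (jPr r i j ε ξ (m - 1) = jPr r i j ε ξ (m + 2)))) ∧
    (∀ m ℓ, 1 ≤ m → m ≤ r → 1 ≤ ℓ → ℓ ≤ r →
      (IMem n r i j ε (i m) (j ℓ) ↔
        IMem (Nval r i j) r (iPr r i j ε ξ) (jPr r i j ε ξ) ε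
          (iPr r i j ε ξ m) (jPr r i j ε ξ ℓ))) := by
  have hp' := isPrimeSnake_height hr hp hξ
  have hthree := fun p h1 h => height_eq_add_three_iff (p := p) hp hξ h1 h
  refine ⟨hp', fun m h2 hm => ?_, fun m l hm1 hm hl1 hl => ?_⟩
  · have := hthree (m - 1) (by omega) (by omega)
    rwa [show m - 1 + 3 = m + 2 by omega] at this
  have hε1 := hp.1.1.2.1 1 le_rfl (by omega)
  have hεr := hp.1.1.2.1 (r - 1) (by omega) (by omega)
  have htouch : j (r - ε (r - 1)) = i (r - 1 + ε (r - 1)) := by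
    obtain ⟨s, hs1, hs, rfl⟩ := hjmin.1
    obtain ⟨t, ht1, ht, rfl⟩ := himax.1
    have a := hp.extremal hr hs1 hs
    have b := hp.extremal hr ht1 ht
    have c := hjmin.2 ⟨r - ε (r - 1), by omega, by omega, rfl⟩
    have d := himax.2 ⟨r - 1 + ε (r - 1), by omega, by omega, rfl⟩
    omega
  have hwidth : j (1 + ε 1) - i (2 - ε 1) = (n : ℤ) + 1 := by
    obtain ⟨s, hs1, hs, rfl⟩ := hjmax.1
    obtain ⟨t, ht1, ht, rfl⟩ := himin.1
    have a := hp.extremal hr hs1 hs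
    have b := hp.extremal hr ht1 ht
    have c := hjmax.2 ⟨1 + ε 1, by omega, by omega, rfl⟩
    have d := himin.2 ⟨2 - ε 1, by omega, by omega, rfl⟩
    omega
  have htouch' : jPr r i j ε ξ (r - ε (r - 1)) = iPr r i j ε ξ (r - 1 + ε (r - 1)) := by
    obtain ⟨k, rfl⟩ : ∃ k, r = k + 1 := ⟨r - 1, by omega⟩
    rw [Nat.add_sub_cancel] at hεr ⊢
    have a := hξ.step (m := k) (by omega) le_rfl (hp.1.1.2.2.2.1 k (by omega) le_rfl).1
    have b := jPr_sub_iPr (k + 1) i j ε ξ (k + 1)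
    rw [sIdx_last] at b
    rcases (by omega : ε k = 0 ∨ ε k = 1) with h0 | h0
    · have := a.1 h0
      simp only [h0, Nat.sub_zero, Nat.add_zero]
      omega
    · have := a.2 h0
      rw [h0, Nat.add_sub_cancel]
      omega
  have hwidth' : jPr r i j ε ξ (1 + ε 1) - iPr r i j ε ξ (2 - ε 1) =
      (Nval r i j : ℤ) + 1 := by
    have a := hξ.step (m := 1) le_rfl (by omega) (hp.1.1.2.2.2.1 1 le_rfl (by omega)).1
    have b := jPr_sub_iPr r i j ε ξ 1
    rw [sIdx_first hr] at b
    rcases (by omega : ε 1 = 0 ∨ ε 1 = 1) with h0 | h0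
    · have := a.1 h0
      simp only [h0, Nat.sub_zero, Nat.add_zero]
      norm_num at this
      omega
    · have := a.2 h0
      rw [h0]
      norm_num at this ⊢
      omega
  have hi : ∀ {p q}, 1 ≤ p → p ≤ r → 1 ≤ q → q ≤ r →
      (i p = i q ↔ iPr r i j ε ξ p = iPr r i j ε ξ q) :=
    eq_iff_eq_of_eq_add_three (fun _ _ h1 h h' he => hp.eq_add_three h1 h h' (Or.inl he))
      (fun _ _ h1 h h' he => hp'.eq_add_three h1 h h' (Or.inl he))
      (fun p h1 h => (hthree p h1 h).1)
  have hj : ∀ {p q}, 1 ≤ p → p ≤ r → 1 ≤ q → q ≤ r →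
      (j p = j q ↔ jPr r i j ε ξ p = jPr r i j ε ξ q) :=
    eq_iff_eq_of_eq_add_three (fun _ _ h1 h h' he => hp.eq_add_three h1 h h' (Or.inr he))
      (fun _ _ h1 h h' he => hp'.eq_add_three h1 h h' (Or.inr he))
      (fun p h1 h => (hthree p h1 h).2)
  rw [hp.iMem_iff hr htouch hwidth hm1 hm hl1 hl, hp'.iMem_iff hr htouch' hwidth' hm1 hm hl1 hl,
    hi hm1 hm (by omega) (by omega), hi hm1 hm (by omega) (by omega),
    hj hl1 hl (by omega) (by omega), hj hl1 hl (by omega) (by omega)]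
  refine and_congr_left fun _ => exists_congr fun p => exists_congr fun q => ?_
  refine and_congr_right fun hp1 => and_congr_right fun hpr => and_congr_right fun hq1 =>
    and_congr_right fun hqr => and_congr_right fun _ => ?_
  rw [hi hm1 hm hp1 hpr, hj hl1 hl hq1 hqr]
end
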